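/- If projective transformations [a_1], …, [a_m] ∈ PGL(V) form a ping-pong m-tuple, then the subgroup of PGL(V) they generate is free of rank m: the group homomorphism from the free group on m generators to PGL(V) sending the i-th generator to [a_i] is injective. In particular, if [a], [b] form a ping-pong pair, then ⟨[a],[b]⟩ is a free group of rank 2. -/

import Mathlib

open Matrix

noncomputable section

/-- The absolute value of `k` is non-archimedean (ultrametric). -/
def IsNonarch (k : Type*) [NormedField k] : Prop := ∀ a b : k, ‖a + b‖ ≤ max ‖a‖ ‖b‖

variable {k : Type*} [NontriviallyNormedField k] {d : ℕ}

open Classical in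
/-- The canonical norm on `k^d`. -/
def vnorm (x : Fin d → k) : ℝ :=
  if IsNonarch k then ⨆ i, ‖x i‖ else Real.sqrt (∑ i, ‖x i‖ ^ 2)

open Classical in
/-- The norm of `x ∧ y` in `Λ² k^d`. -/
def wnorm (x y : Fin d → k) : ℝ :=
  if IsNonarch k then ⨆ p : Fin d × Fin d, ‖x p.1 * y p.2 - x p.2 * y p.1‖
  else Real.sqrt (∑ p : Fin d × Fin d,
    if p.1 < p.2 then ‖x p.1 * y p.2 - x p.2 * y p.1‖ ^ 2 else 0)

/-- The Fubini–Study distance between the directions of two nonzero vectors. -/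
def pdist (x y : Fin d → k) : ℝ := wnorm x y / (vnorm x * vnorm y)

/-- `δ([x], H)` where `H = ker f` and the linear form `f` has coordinate vector `c`. -/
def pdistH (x c : Fin d → k) : ℝ := ‖∑ i, c i * x i‖ / (vnorm c * vnorm x)

/-- The Fubini–Study distance on the projective space `P(k^d)`. -/
def pdelta (P Q : Projectivization k (Fin d → k)) : ℝ := pdist P.rep Q.rep

/-- Distance from a point of `P(k^d)` to the projective hyperplane defined by the
linear form with coordinate vector `c`. -/
def pdeltaH (P : Projectivization k (Fin d → k)) (c : Fin d → k) : ℝ := pdistH P.rep c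

lemma glInjective (g : Matrix.GeneralLinearGroup (Fin d) k) :
    Function.Injective ((g : Matrix (Fin d) (Fin d) k).mulVecLin) := by
  intro x y h
  simp only [Matrix.mulVecLin_apply] at h
  have h2 := congrArg (fun v => ((↑g⁻¹ : Matrix (Fin d) (Fin d) k)).mulVec v) h
  simp only [Matrix.mulVec_mulVec] at h2
  rwa [← Units.val_mul, inv_mul_cancel, Units.val_one, Matrix.one_mulVec,
    Matrix.one_mulVec] at h2

/-- The projective transformation of `P(k^d)` induced by `g ∈ GL_d(k)`; the
homomorphism `GL_d(k) → PGL_d(k)` composed with the faithful action of `PGL_d(k)`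
on `P(k^d)`. -/
def pactGL (g : Matrix.GeneralLinearGroup (Fin d) k) :
    Projectivization k (Fin d → k) → Projectivization k (Fin d → k) :=
  Projectivization.map ((g : Matrix (Fin d) (Fin d) k).mulVecLin) (glInjective g)

/-- `[g]` is `ε`-contracting with attracting point `v` and repelling hyperplane the
kernel of the form with coordinates `c`. -/
def EpsContracting (g : Matrix.GeneralLinearGroup (Fin d) k)
    (v : Projectivization k (Fin d → k)) (c : Fin d → k) (ε : ℝ) : Prop :=
  ∀ Q : Projectivization k (Fin d → k), ε < pdeltaH Q c → pdelta (pactGL g Q) v < ε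

/-- `[g]` is `(r, ε)`-proximal with the given attracting point and repelling
hyperplane data. -/
def RProximal (g : Matrix.GeneralLinearGroup (Fin d) k)
    (v : Projectivization k (Fin d → k)) (c : Fin d → k) (r ε : ℝ) : Prop :=
  EpsContracting g v c ε ∧ r < pdeltaH v c

/-- `a_1, …, a_m` form a ping-pong `m`-tuple: each `a_i` is `(r,ε)`-very proximal
for some `r > 2ε > 0`, and for `i ≠ j` the attracting points of `a_i, a_i⁻¹` are at
distance at least `r` from the repelling hyperplanes of `a_j, a_j⁻¹`. -/
def PingPongTuple {m : ℕ} (a : Fin m → Matrix.GeneralLinearGroup (Fin d) k) : Prop :=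
  ∃ (r ε : ℝ) (v w : Fin m → Projectivization k (Fin d → k))
    (c cw : Fin m → (Fin d → k)),
    0 < ε ∧ 2 * ε < r ∧ (∀ i, c i ≠ 0) ∧ (∀ i, cw i ≠ 0) ∧
    (∀ i, RProximal (a i) (v i) (c i) r ε) ∧
    (∀ i, RProximal (a i)⁻¹ (w i) (cw i) r ε) ∧
    (∀ i j, i ≠ j →
      r ≤ pdeltaH (v i) (c j) ∧ r ≤ pdeltaH (v i) (cw j) ∧
      r ≤ pdeltaH (w i) (c j) ∧ r ≤ pdeltaH (w i) (cw j))

end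

theorem arch_embed {k : Type*} [NontriviallyNormedField k] [CompleteSpace k]
    [LocallyCompactSpace k] (h : ¬ IsNonarch k) :
    ∃ (φ : k →+* ℂ) (α : ℝ), 0 < α ∧ α ≤ 1 ∧ (∀ x, ‖x‖ = ‖φ x‖ ^ α) ∧
      ∀ t : ℝ, 0 < t → ∃ s : k, ‖s‖ = t := by
  have hn : ¬ ∀ n : ℕ, ‖(n : k)‖ ≤ 1 := by
    intro hn
    have := IsUltrametricDist.isUltrametricDist_of_forall_norm_natCast_le_one (R := k) hn
    exact h fun a b => IsUltrametricDist.norm_add_le_max a b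
  have hc : CharZero k := by
    rcases CharP.exists k with ⟨p, hp⟩
    rcases Nat.eq_zero_or_pos p with rfl | hpos
    · exact CharP.charP_to_charZero k
    · exfalso
      apply hn
      intro n
      by_contra hgt
      push Not at hgt
      have h1 : ∀ m : ℕ, ‖(m : k)‖ ≤ p := by
        intro m
        have : (m : k) = ((m % p : ℕ) : k) := by
          rw [CharP.natCast_eq_natCast k p]
          exact (Nat.mod_modEq m p).symm
        rw [this]
        calc ‖((m % p : ℕ) : k)‖ ≤ (m % p : ℕ) * ‖(1:k)‖ := by
              simpa using Nat.norm_cast_le (α := k) (m % p)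
          _ ≤ p := by
              simp only [norm_one, mul_one]
              exact_mod_cast (Nat.mod_lt m hpos).le
      obtain ⟨N, hN⟩ := pow_unbounded_of_one_lt (p : ℝ) hgt
      have h2 := h1 (n ^ N)
      rw [Nat.cast_pow, norm_pow] at h2
      linarith
  let f : AbsoluteValue ℚ ℝ :=
    { toFun := fun q => ‖(q : k)‖
      map_mul' := by intro x y; simp
      nonneg' := by intro x; exact norm_nonneg _
      eq_zero' := by intro x; simp
      add_le' := by intro x y; simpa using norm_add_le (x : k) (y : k) }
  have hf : ∀ q, f q = ‖(q : k)‖ := fun q => rfl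
  have hfeq : f.IsEquiv Rat.AbsoluteValue.real := by
    apply Rat.AbsoluteValue.equiv_real_of_unbounded
    intro hb
    apply hn
    intro n
    simpa [hf] using hb n
  obtain ⟨β, hβ, hβf⟩ := AbsoluteValue.isEquiv_iff_exists_rpow_eq.1 hfeq.symm
  have hq : ∀ q : ℚ, ‖(q : k)‖ = |(q : ℝ)| ^ β := by
    intro q
    have := congrFun hβf q
    simp only [Rat.AbsoluteValue.real_eq_abs] at this
    rw [← hf, ← this]
    simp
  have huc : UniformContinuous (Rat.castHom k) := by
    rw [Metric.uniformContinuous_iff]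
    intro ε hε
    refine ⟨ε ^ β⁻¹, Real.rpow_pos_of_pos hε _, ?_⟩
    intro a b hab
    rw [Rat.dist_eq] at hab
    rw [dist_eq_norm, ← map_sub, Rat.coe_castHom, hq]
    calc |((a - b : ℚ) : ℝ)| ^ β < (ε ^ β⁻¹) ^ β := by
          apply Real.rpow_lt_rpow (abs_nonneg _) _ hβ
          simpa using hab
      _ = ε := by rw [← Real.rpow_mul hε.le, inv_mul_cancel₀ hβ.ne', Real.rpow_one]
  have hui : IsUniformInducing (Rat.castHom ℝ) :=
    Rat.isUniformEmbedding_coe_real.isUniformInducing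
  have hdr : DenseRange (Rat.castHom ℝ) := Rat.denseRange_cast
  let ι : ℝ →+* k := IsDenseInducing.extendRingHom hui hdr huc
  have hιc : Continuous ι :=
    (uniformContinuous_uniformly_extend hui hdr huc).continuous
  have hιn : ∀ t : ℝ, ‖ι t‖ = |t| ^ β := by
    intro t
    refine DenseRange.induction_on hdr t ?_ ?_
    · apply isClosed_eq
      · fun_prop
      · exact continuous_abs.rpow_const (fun _ => Or.inr hβ.le)
    · intro q
      have : ι (Rat.castHom ℝ q) = (q : k) := by simp
      rw [this, hq]; rfl
  let _ : Algebra ℝ k := ι.toAlgebra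
  have : ContinuousSMul ℝ k := ⟨by
    have : (fun p : ℝ × k => p.1 • p.2) = fun p => ι p.1 * p.2 := by
      funext p; rw [Algebra.smul_def]; rfl
    rw [this]; fun_prop⟩
  have : FiniteDimensional ℝ k := FiniteDimensional.of_locallyCompactSpace ℝ
  let φ : k →ₐ[ℝ] ℂ := IsAlgClosed.lift
  have hφc : Continuous φ := φ.toLinearMap.continuous_of_finiteDimensional
  let v : AbsoluteValue k ℝ := NormedField.toAbsoluteValue k
  let w : AbsoluteValue k ℝ := (NormedField.toAbsoluteValue ℂ).comp (f := (φ : k →+* ℂ)) (RingHom.injective _)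
  have hv : ∀ x, v x = ‖x‖ := fun x => rfl
  have hw : ∀ x, w x = ‖φ x‖ := fun x => rfl
  have hnt : v.IsNontrivial := by
    obtain ⟨x, hx⟩ := NormedField.exists_one_lt_norm k
    refine ⟨x, ?_, ?_⟩
    · rintro rfl; simp at hx; linarith
    · rw [hv]; exact hx.ne'
  have hvw : v.IsEquiv w := by
    apply AbsoluteValue.isEquiv_of_lt_one_imp hnt
    intro x hx
    rw [hv] at hx
    rw [hw]
    have h1 := tendsto_pow_atTop_nhds_zero_of_norm_lt_one hx
    have h2 := (hφc.tendsto 0).comp h1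
    rw [map_zero] at h2
    by_contra hge
    push Not at hge
    have h3 := h2.norm
    rw [norm_zero] at h3
    have h4 := h3.eventually (gt_mem_nhds (zero_lt_one))
    obtain ⟨n, hn⟩ := h4.exists
    simp only [Function.comp, map_pow, norm_pow] at hn
    exact absurd hn (not_lt.2 (one_le_pow₀ hge))
  obtain ⟨α, hα, hαe⟩ := AbsoluteValue.isEquiv_iff_exists_rpow_eq.1 hvw.symm
  have hnorm : ∀ x, ‖x‖ = ‖φ x‖ ^ α := fun x => (congrFun hαe x).symm
  refine ⟨φ, α, hα, ?_, hnorm, ?_⟩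
  · have h2 := hnorm 2
    have h3 : ‖(2:k)‖ ≤ 2 := by simpa using Nat.norm_cast_le (α := k) 2
    rw [h2, map_ofNat] at h3
    simp only [Complex.norm_ofNat] at h3
    by_contra hlt
    push Not at hlt
    have := Real.rpow_lt_rpow_of_exponent_lt (x := 2) (by norm_num) hlt
    rw [Real.rpow_one] at this
    linarith
  · intro t ht
    refine ⟨ι (t ^ β⁻¹), ?_⟩
    rw [hιn, abs_of_pos (Real.rpow_pos_of_pos ht _), ← Real.rpow_mul ht.le,
      inv_mul_cancel₀ hβ.ne', Real.rpow_one]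

/-- Lagrange's identity bound. -/
theorem lagrange_bound {d : ℕ} (c b : Fin d → ℂ) :
    ∑ p : Fin d × Fin d, ‖c p.1 * b p.2 - c p.2 * b p.1‖ ^ 2 ≤
      2 * ((∑ i, ‖c i‖ ^ 2) * ∑ i, ‖b i‖ ^ 2) := by
  have key : ((∑ p : Fin d × Fin d, ‖c p.1 * b p.2 - c p.2 * b p.1‖ ^ 2 : ℝ) : ℂ) =
      ((2 * ((∑ i, ‖c i‖ ^ 2) * ∑ i, ‖b i‖ ^ 2) -
        2 * ‖∑ i, c i * (starRingEnd ℂ) (b i)‖ ^ 2 : ℝ) : ℂ) := by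
    push_cast
    simp only [← Complex.mul_conj', map_sum, map_mul, map_sub, Complex.conj_conj]
    rw [Fintype.sum_prod_type]
    have e1 : ∀ i j : Fin d, (c i * b j - c j * b i) *
        ((starRingEnd ℂ) (c i) * (starRingEnd ℂ) (b j) -
          (starRingEnd ℂ) (c j) * (starRingEnd ℂ) (b i)) =
        (c i * (starRingEnd ℂ) (c i)) * (b j * (starRingEnd ℂ) (b j)) +
        (b i * (starRingEnd ℂ) (b i)) * (c j * (starRingEnd ℂ) (c j)) -
        (c i * (starRingEnd ℂ) (b i)) * ((starRingEnd ℂ) (c j) * b j) -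
        ((starRingEnd ℂ) (c i) * b i) * (c j * (starRingEnd ℂ) (b j)) := by
      intro i j; ring
    simp only [e1, Finset.sum_add_distrib, Finset.sum_sub_distrib, ← Finset.mul_sum,
      ← Finset.sum_mul]
    ring
  have key' := Complex.ofReal_injective key
  rw [key']
  have := sq_nonneg ‖∑ i, c i * (starRingEnd ℂ) (b i)‖
  linarith

/-- Sum over all pairs of a symmetric function vanishing on the diagonal. -/
theorem sum_pairs {d : ℕ} (g : Fin d → Fin d → ℝ) (hs : ∀ i j, g i j = g j i)
    (h0 : ∀ i, g i i = 0) :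
    ∑ p : Fin d × Fin d, g p.1 p.2 =
      2 * ∑ p : Fin d × Fin d, if p.1 < p.2 then g p.1 p.2 else 0 := by
  have h1 : ∀ p : Fin d × Fin d, g p.1 p.2 = (if p.1 < p.2 then g p.1 p.2 else 0) +
      (if p.2 < p.1 then g p.2 p.1 else 0) := by
    rintro ⟨i, j⟩
    rcases lt_trichotomy i j with h | h | h
    · simp [h, h.not_gt]
    · subst h; simp [h0]
    · simp [h, h.not_gt, hs i j]
  rw [Finset.sum_congr rfl (fun p _ => h1 p), Finset.sum_add_distrib]
  have h2 : ∑ p : Fin d × Fin d, (if p.2 < p.1 then g p.2 p.1 else 0) =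
      ∑ p : Fin d × Fin d, (if p.1 < p.2 then g p.1 p.2 else 0) :=
    (Equiv.prodComm (Fin d) (Fin d)).sum_comp
      (fun p : Fin d × Fin d => if p.1 < p.2 then g p.1 p.2 else 0)
  rw [h2]; ring

/-- the `ℓ²` bound for trilinear form -/
theorem l2_bound {d : ℕ} (c b : Fin d → ℂ) (A : Fin d → Fin d → ℂ)
    (hA : ∀ i j, A j i = - A i j) :
    ‖∑ j, ∑ i, b j * (c i * A i j)‖ ^ 2 ≤ (∑ i, ‖b i‖ ^ 2) * ((∑ i, ‖c i‖ ^ 2) *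
      ∑ p : Fin d × Fin d, if p.1 < p.2 then ‖A p.1 p.2‖ ^ 2 else 0) := by
  have hsum : 2 * (∑ j, ∑ i, b j * (c i * A i j)) =
      ∑ p : Fin d × Fin d, A p.1 p.2 * (c p.1 * b p.2 - c p.2 * b p.1) := by
    rw [Fintype.sum_prod_type]
    simp only [mul_sub, Finset.sum_sub_distrib]
    have e1 : ∑ i, ∑ j, A i j * (c i * b j) = ∑ j, ∑ i, b j * (c i * A i j) := by
      rw [Finset.sum_comm]
      exact Finset.sum_congr rfl fun j _ => Finset.sum_congr rfl fun i _ => by ring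
    have e2 : ∑ i, ∑ j, A i j * (c j * b i) = - ∑ j, ∑ i, b j * (c i * A i j) := by
      rw [← Finset.sum_neg_distrib]
      refine Finset.sum_congr rfl fun j _ => ?_
      rw [← Finset.sum_neg_distrib]
      exact Finset.sum_congr rfl fun i _ => by rw [hA i j]; ring
    rw [e1, e2]; ring
  have h1 : (2 * ‖∑ j, ∑ i, b j * (c i * A i j)‖) ^ 2 ≤
      (∑ p : Fin d × Fin d, ‖A p.1 p.2‖ ^ 2) *
        ∑ p : Fin d × Fin d, ‖c p.1 * b p.2 - c p.2 * b p.1‖ ^ 2 := by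
    have : 2 * ‖∑ j, ∑ i, b j * (c i * A i j)‖ =
        ‖2 * (∑ j, ∑ i, b j * (c i * A i j))‖ := by simp
    rw [this, hsum]
    refine le_trans ?_ (Finset.sum_mul_sq_le_sq_mul_sq _ _ _)
    apply pow_le_pow_left₀ (norm_nonneg _)
    refine (norm_sum_le _ _).trans ?_
    simp
  have h2 := sum_pairs (fun i j => ‖A i j‖ ^ 2) (fun i j => by rw [hA i j, norm_neg])
    (fun i => by
      have : A i i = 0 := by
        have := hA i i
        linear_combination (1/2 : ℂ) * this
      simp [this])
  have h3 := lagrange_bound c b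
  have h4 : 0 ≤ ∑ p : Fin d × Fin d, ‖A p.1 p.2‖ ^ 2 :=
    Finset.sum_nonneg fun _ _ => sq_nonneg _
  have h5 := mul_le_mul_of_nonneg_left h3 h4
  rw [h2] at h5 h1
  nlinarith

/-- `a ^ z` for real `a`, with a harmless value at `a = 0`. -/
noncomputable def cexpow (a : ℝ) (z : ℂ) : ℂ := Complex.exp ((Real.log a : ℂ) * z)

theorem norm_cexpow {a : ℝ} (ha : 0 < a) (z : ℂ) : ‖cexpow a z‖ = a ^ z.re := by
  rw [cexpow, Complex.norm_exp, Complex.re_ofReal_mul, Real.rpow_def_of_pos ha]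

theorem cexpow_ofReal {a : ℝ} (ha : 0 < a) (t : ℝ) : cexpow a t = ((a ^ t : ℝ) : ℂ) := by
  rw [cexpow, Real.rpow_def_of_pos ha, Complex.ofReal_exp, Complex.ofReal_mul]

/-- the analytic family `x |x|^{-1} (|x|^p)^z`. -/
noncomputable def cfam (p : ℝ) (x : ℂ) (z : ℂ) : ℂ := x / (‖x‖ : ℂ) * cexpow (‖x‖ ^ p) z

theorem norm_cfam (p : ℝ) {x z : ℂ} (hz : x ≠ 0 ∨ z.re ≠ 0) (hp : p ≠ 0) :
    ‖cfam p x z‖ = (‖x‖ ^ p) ^ z.re := by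
  rcases eq_or_ne x 0 with rfl | hx
  · have hz' : z.re ≠ 0 := by simpa using hz
    simp [cfam, Real.zero_rpow hp, Real.zero_rpow hz']
  · have h : 0 < ‖x‖ := norm_pos_iff.2 hx
    rw [cfam, norm_mul, norm_cexpow (Real.rpow_pos_of_pos h p)]
    simp [h.ne']

theorem norm_cfam_le (p : ℝ) (x z : ℂ) (hp : p ≠ 0) :
    ‖cfam p x z‖ ≤ (‖x‖ ^ p) ^ z.re := by
  rcases eq_or_ne x 0 with rfl | hx
  · simp only [cfam, zero_div, zero_mul, norm_zero]; positivity
  · exact (norm_cfam p (Or.inl hx) hp).le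

theorem cfam_inv (p : ℝ) (hp : 0 < p) (x : ℂ) : cfam p x ((p⁻¹ : ℝ) : ℂ) = x := by
  rcases eq_or_ne x 0 with rfl | hx
  · simp [cfam]
  · have h : 0 < ‖x‖ := norm_pos_iff.2 hx
    rw [cfam, cexpow_ofReal (Real.rpow_pos_of_pos h p), ← Real.rpow_mul h.le,
      mul_inv_cancel₀ hp.ne', Real.rpow_one]
    field_simp [Complex.ofReal_ne_zero.2 h.ne']

theorem cfam_neg (p : ℝ) (x z : ℂ) : cfam p (-x) z = - cfam p x z := by
  simp [cfam, neg_div]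

theorem cfam_diff (p : ℝ) (x : ℂ) : Differentiable ℂ (cfam p x) := by
  unfold cfam cexpow; fun_prop

theorem rpow_le_max {a s : ℝ} (ha : 0 ≤ a) (h0 : 0 ≤ s) (h1 : s ≤ 1) : a ^ s ≤ 1 + a := by
  rcases le_total a 1 with h | h
  · have := Real.rpow_le_one ha h h0; linarith
  · have := Real.rpow_le_rpow_of_exponent_le h h1
    rw [Real.rpow_one] at this; linarith

theorem sum_all_le {d : ℕ} (u : Fin d → ℝ) (t : Fin d → Fin d → ℝ) (hu : ∀ i, 0 ≤ u i)
    (ht : ∀ i j, 0 ≤ t i j) (hs : ∀ i j, t i j = t j i) (h0 : ∀ i, t i i = 0) :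
    ∑ j, ∑ i, u i * t i j ≤
      (∑ i, u i) * ∑ p : Fin d × Fin d, if p.1 < p.2 then t p.1 p.2 else 0 := by
  rw [Finset.sum_comm, Finset.sum_mul]
  refine Finset.sum_le_sum fun i _ => ?_
  rw [← Finset.mul_sum]
  refine mul_le_mul_of_nonneg_left ?_ (hu i)
  have hsplit : ∀ j, t i j = (if i < j then t i j else 0) + (if j < i then t j i else 0) := by
    intro j
    rcases lt_trichotomy i j with h | h | h
    · simp [h, h.not_gt]
    · subst h; simp [h0]
    · simp [h, h.not_gt, hs i j]
  have hpair : ∀ j, j ≠ i → 0 ≤ t i j := fun j _ => ht i j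
  -- injection of row `i` into the set of ordered pairs
  let e : Fin d → Fin d × Fin d := fun j => if i < j then (i, j) else (j, i)
  have he : Set.InjOn e (Finset.univ : Finset (Fin d)) := by
    intro a _ b _ hab
    simp only [e] at hab
    clear hs h0 hsplit hpair
    split_ifs at hab <;> simp only [Prod.mk.injEq] at hab <;> grind
  calc ∑ j, t i j = ∑ j, (fun p : Fin d × Fin d => if p.1 < p.2 then t p.1 p.2 else 0) (e j) := by
        refine Finset.sum_congr rfl fun j _ => ?_
        simp only [e]
        rcases lt_trichotomy i j with h | h | h
        · simp [h]
        · subst h; simp [h0]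
        · simp [h, h.not_gt, hs i j]
    _ = ∑ p ∈ Finset.univ.image e, (fun p : Fin d × Fin d => if p.1 < p.2 then t p.1 p.2 else 0) p :=
        (Finset.sum_image (f := fun p : Fin d × Fin d =>
          if p.1 < p.2 then t p.1 p.2 else 0) he).symm
    _ ≤ _ := by
        apply Finset.sum_le_sum_of_subset_of_nonneg (Finset.subset_univ _)
        intro p _ _
        split_ifs
        · exact ht _ _
        · exact le_rfl

open Complex.HadamardThreeLines in
/-- Interpolated contraction bound, `1 ≤ p ≤ 2`. -/
theorem lp_bound_ge {d : ℕ} (p : ℝ) (hp1 : 1 ≤ p) (hp2 : p ≤ 2) (c : Fin d → ℂ)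
    (A : Fin d → Fin d → ℂ) (hA : ∀ i j, A j i = - A i j) :
    ∑ j, ‖∑ i, c i * A i j‖ ^ p ≤ (∑ i, ‖c i‖ ^ p) *
      ∑ q : Fin d × Fin d, if q.1 < q.2 then ‖A q.1 q.2‖ ^ p else 0 := by
  have hp0 : 0 < p := by linarith
  have hA0 : ∀ i, A i i = 0 := fun i => by
    have := hA i i
    linear_combination (1/2 : ℂ) * this
  set y : Fin d → ℂ := fun j => ∑ i, c i * A i j with hy
  set N := ∑ j, ‖y j‖ ^ p with hN
  set M := (∑ i, ‖c i‖ ^ p) * ∑ q : Fin d × Fin d, if q.1 < q.2 then ‖A q.1 q.2‖ ^ p else 0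
    with hM
  have hM0 : 0 ≤ M := by
    refine mul_nonneg (Finset.sum_nonneg fun _ _ => by positivity)
      (Finset.sum_nonneg fun _ _ => ?_)
    split_ifs <;> positivity
  by_contra hlt
  push Not at hlt
  have hN0 : 0 < N := lt_of_le_of_lt hM0 hlt
  let B : Fin d → ℂ → ℂ := fun j z => cfam p ((starRingEnd ℂ) (y j)) ((1 - z) / 2)
  let F : ℂ → ℂ := fun z => ∑ j, ∑ i, B j z *
    (cfam p (c i) ((1 + z) / 2) * cfam p (A i j) ((1 + z) / 2))
  have hFd : Differentiable ℂ F := by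
    have h1 : ∀ x, Differentiable ℂ fun z : ℂ => cfam p x ((1 - z) / 2) := fun x =>
      (cfam_diff p x).comp (by fun_prop)
    have h2 : ∀ x, Differentiable ℂ fun z : ℂ => cfam p x ((1 + z) / 2) := fun x =>
      (cfam_diff p x).comp (by fun_prop)
    refine Differentiable.fun_sum fun j _ => Differentiable.fun_sum fun i _ => ?_
    exact (h1 _).mul ((h2 _).mul (h2 _))
  have re1 : ∀ z : ℂ, ((1 - z) / 2).re = (1 - z.re) / 2 := by intro z; simp
  have re2 : ∀ z : ℂ, ((1 + z) / 2).re = (1 + z.re) / 2 := by intro z; simp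
  have hterm : ∀ z i j, ‖B j z * (cfam p (c i) ((1 + z) / 2) * cfam p (A i j) ((1 + z) / 2))‖ ≤
      (‖y j‖ ^ p) ^ ((1 - z.re) / 2) * ((‖c i‖ ^ p) ^ ((1 + z.re) / 2) *
        (‖A i j‖ ^ p) ^ ((1 + z.re) / 2)) := by
    intro z i j
    rw [norm_mul, norm_mul]
    have h1 := norm_cfam_le p ((starRingEnd ℂ) (y j)) ((1 - z) / 2) hp0.ne'
    have h2 := norm_cfam_le p (c i) ((1 + z) / 2) hp0.ne'
    have h3 := norm_cfam_le p (A i j) ((1 + z) / 2) hp0.ne'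
    rw [re1, RCLike.norm_conj] at h1
    rw [re2] at h2 h3
    gcongr
  have hbdd : BddAbove ((norm ∘ F) '' verticalClosedStrip 0 1) := by
    refine ⟨∑ j, ∑ i, (1 + ‖y j‖ ^ p) * ((1 + ‖c i‖ ^ p) * (1 + ‖A i j‖ ^ p)), ?_⟩
    rintro _ ⟨z, hz, rfl⟩
    have hz' : 0 ≤ z.re ∧ z.re ≤ 1 := hz
    refine (norm_sum_le _ _).trans (Finset.sum_le_sum fun j _ =>
      (norm_sum_le _ _).trans (Finset.sum_le_sum fun i _ => (hterm z i j).trans ?_))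
    have h1 := rpow_le_max (a := ‖y j‖ ^ p) (s := (1 - z.re) / 2) (by positivity)
      (by linarith) (by linarith)
    have h2 := rpow_le_max (a := ‖c i‖ ^ p) (s := (1 + z.re) / 2) (by positivity)
      (by linarith) (by linarith)
    have h3 := rpow_le_max (a := ‖A i j‖ ^ p) (s := (1 + z.re) / 2) (by positivity)
      (by linarith) (by linarith)
    gcongr
  have hsq : ∀ x z : ℂ, z.re = 1 / 2 → ‖cfam p x z‖ ^ 2 = ‖x‖ ^ p := by
    intro x z hz
    rw [norm_cfam p (Or.inr (by rw [hz]; norm_num)) hp0.ne', hz, ← Real.sqrt_eq_rpow,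
      Real.sq_sqrt (by positivity)]
  have hleft : ∀ z ∈ Complex.re ⁻¹' {(0 : ℝ)}, ‖F z‖ ≤ Real.sqrt (N * M) := by
    intro z hz
    have hz : z.re = 0 := hz
    apply Real.le_sqrt_of_sq_le
    have h := l2_bound (fun i => cfam p (c i) ((1 + z) / 2)) (fun j => B j z)
      (fun i j => cfam p (A i j) ((1 + z) / 2)) (fun i j => by rw [hA i j, cfam_neg])
    refine h.trans (le_of_eq ?_)
    have e1 : ((1 - z) / 2).re = 1 / 2 := by rw [re1, hz]; norm_num
    have e2 : ((1 + z) / 2).re = 1 / 2 := by rw [re2, hz]; norm_num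
    simp only [B, hsq _ _ e1, hsq _ _ e2, RCLike.norm_conj]
    rfl
  have hright : ∀ z ∈ Complex.re ⁻¹' {(1 : ℝ)}, ‖F z‖ ≤ Real.sqrt (N * M) := by
    intro z hz
    have hz : z.re = 1 := hz
    have h1 : ‖F z‖ ≤ M := by
      refine le_trans ?_ (sum_all_le (fun i => ‖c i‖ ^ p) (fun i j => ‖A i j‖ ^ p)
        (fun i => by positivity) (fun i j => by positivity)
        (fun i j => by rw [hA i j, norm_neg])
        (fun i => by simp [hA0, Real.zero_rpow hp0.ne']))
      refine (norm_sum_le _ _).trans (Finset.sum_le_sum fun j _ =>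
        (norm_sum_le _ _).trans (Finset.sum_le_sum fun i _ => (hterm z i j).trans ?_))
      rw [hz]
      norm_num
    refine h1.trans (Real.le_sqrt_of_sq_le ?_)
    nlinarith
  -- the interpolation point
  have hs0 : 0 ≤ 2 / p - 1 := by
    have : 1 ≤ 2 / p := by rw [le_div_iff₀ hp0]; linarith
    linarith
  have hs1 : 2 / p - 1 ≤ 1 := by
    have : 2 / p ≤ 2 := by rw [div_le_iff₀ hp0]; linarith
    linarith
  have hmain := norm_le_interp_of_mem_verticalClosedStrip₀₁' F
    (z := ((2 / p - 1 : ℝ) : ℂ)) (a := Real.sqrt (N * M)) (b := Real.sqrt (N * M))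
    (by
      change 0 ≤ ((2 / p - 1 : ℝ) : ℂ).re ∧ ((2 / p - 1 : ℝ) : ℂ).re ≤ 1
      rw [Complex.ofReal_re]; exact ⟨hs0, hs1⟩)
    hFd.diffContOnCl hbdd hleft hright
  rw [Complex.ofReal_re] at hmain
  have hF : F ((2 / p - 1 : ℝ) : ℂ) = ((N : ℝ) : ℂ) := by
    have e2 : (1 + ((2 / p - 1 : ℝ) : ℂ)) / 2 = ((p⁻¹ : ℝ) : ℂ) := by
      push_cast; ring
    have e1 : (1 - ((2 / p - 1 : ℝ) : ℂ)) / 2 = ((1 - p⁻¹ : ℝ) : ℂ) := by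
      push_cast; ring
    simp only [F, B, e1, e2, cfam_inv p hp0, ← Finset.mul_sum]
    rw [hN, Complex.ofReal_sum]
    refine Finset.sum_congr rfl fun j _ => ?_
    change cfam p ((starRingEnd ℂ) (y j)) ((1 - p⁻¹ : ℝ) : ℂ) * y j = _
    rcases eq_or_ne (y j) 0 with h0 | h0
    · simp [h0, Real.zero_rpow hp0.ne']
    · have hpos : 0 < ‖y j‖ := norm_pos_iff.2 h0
      rw [cfam, RCLike.norm_conj, cexpow_ofReal (Real.rpow_pos_of_pos hpos p)]
      have e3 : (starRingEnd ℂ) (y j) / (‖y j‖ : ℂ) * (((‖y j‖ ^ p) ^ (1 - p⁻¹) : ℝ) : ℂ) * y j =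
          (y j * (starRingEnd ℂ) (y j)) / (‖y j‖ : ℂ) * (((‖y j‖ ^ p) ^ (1 - p⁻¹) : ℝ) : ℂ) := by
        ring
      rw [e3, Complex.mul_conj', ← Real.rpow_mul hpos.le]
      have e4 : p * (1 - p⁻¹) = p - 1 := by field_simp
      rw [e4, Real.rpow_sub_one hpos.ne']
      have : (‖y j‖ : ℂ) ≠ 0 := Complex.ofReal_ne_zero.2 hpos.ne'
      push_cast
      field_simp
  rw [hF, Complex.norm_real, Real.norm_of_nonneg hN0.le] at hmain
  have hle : N ≤ Real.sqrt (N * M) := by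
    rcases (Real.sqrt_nonneg (N * M)).eq_or_lt with h0 | h0
    · have hle : (Real.sqrt (N * M)) ^ (1 - (2 / p - 1)) * (Real.sqrt (N * M)) ^ (2 / p - 1) ≤
        Real.sqrt (N * M) := by
        rcases eq_or_ne (2 / p - 1) 0 with h1 | h1
        · rw [h1]; simp
        · rw [← h0, Real.zero_rpow h1]; simp
      linarith
    · rw [← Real.rpow_add h0] at hmain
      simpa using hmain
  have h2 := Real.sq_sqrt (mul_nonneg hN0.le hM0)
  have h3 : N ^ 2 ≤ N * M := by
    rw [← h2]; exact pow_le_pow_left₀ hN0.le hle 2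
  nlinarith

theorem rpow_norm_sum_le {ι : Type*} (s : Finset ι) (f : ι → ℂ) {p : ℝ} (hp0 : 0 < p)
    (hp1 : p ≤ 1) : ‖∑ i ∈ s, f i‖ ^ p ≤ ∑ i ∈ s, ‖f i‖ ^ p := by
  classical
  induction s using Finset.induction_on with
  | empty => simp [Real.zero_rpow hp0.ne']
  | insert a s ha ih =>
    rw [Finset.sum_insert ha, Finset.sum_insert ha]
    calc ‖f a + ∑ i ∈ s, f i‖ ^ p ≤ (‖f a‖ + ‖∑ i ∈ s, f i‖) ^ p :=
          Real.rpow_le_rpow (norm_nonneg _) (norm_add_le _ _) hp0.le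
      _ ≤ ‖f a‖ ^ p + ‖∑ i ∈ s, f i‖ ^ p :=
          Real.rpow_add_le_add_rpow (norm_nonneg _) (norm_nonneg _) hp0.le hp1
      _ ≤ _ := by linarith

theorem lp_bound {d : ℕ} (p : ℝ) (hp0 : 0 < p) (hp2 : p ≤ 2) (c : Fin d → ℂ)
    (A : Fin d → Fin d → ℂ) (hA : ∀ i j, A j i = - A i j) :
    ∑ j, ‖∑ i, c i * A i j‖ ^ p ≤ (∑ i, ‖c i‖ ^ p) *
      ∑ q : Fin d × Fin d, if q.1 < q.2 then ‖A q.1 q.2‖ ^ p else 0 := by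
  rcases le_total 1 p with hp1 | hp1
  · exact lp_bound_ge p hp1 hp2 c A hA
  · have hA0 : ∀ i, A i i = 0 := fun i => by
      have := hA i i
      linear_combination (1/2 : ℂ) * this
    refine le_trans ?_ (sum_all_le (fun i => ‖c i‖ ^ p) (fun i j => ‖A i j‖ ^ p)
        (fun i => by positivity) (fun i j => by positivity)
        (fun i j => by rw [hA i j, norm_neg])
        (fun i => by simp [hA0, Real.zero_rpow hp0.ne']))
    refine Finset.sum_le_sum fun j _ => (rpow_norm_sum_le _ _ hp0 hp1).trans
      (Finset.sum_le_sum fun i _ => ?_)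
    rw [norm_mul, Real.mul_rpow (norm_nonneg _) (norm_nonneg _)]

section geometry

variable {k : Type*} [NontriviallyNormedField k] {d : ℕ}

theorem vnorm_nonarch (h : IsNonarch k) (x : Fin d → k) : vnorm x = ‖x‖ := by
  rw [vnorm, if_pos h]
  rcases isEmpty_or_nonempty (Fin d) with he | hne
  · simp [Real.iSup_of_isEmpty, Subsingleton.elim x 0]
  · apply le_antisymm
    · exact ciSup_le fun i => norm_le_pi_norm x i
    · rw [pi_norm_le_iff_of_nonempty]
      exact fun i => le_ciSup (f := fun i => ‖x i‖) (Set.finite_range _).bddAbove i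

theorem vnorm_arch (h : ¬ IsNonarch k) (x : Fin d → k) :
    vnorm x = ‖(WithLp.toLp 2 x : PiLp 2 fun _ : Fin d => k)‖ := by
  rw [vnorm, if_neg h, PiLp.norm_eq_of_L2]

theorem vnorm_smul (s : k) (x : Fin d → k) : vnorm (s • x) = ‖s‖ * vnorm x := by
  by_cases h : IsNonarch k
  · rw [vnorm_nonarch h, vnorm_nonarch h, norm_smul]
  · rw [vnorm_arch h, vnorm_arch h, WithLp.toLp_smul, norm_smul]

theorem vnorm_add_le (x y : Fin d → k) : vnorm (x + y) ≤ vnorm x + vnorm y := by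
  by_cases h : IsNonarch k
  · simp only [vnorm_nonarch h]; exact norm_add_le _ _
  · simp only [vnorm_arch h, WithLp.toLp_add]; exact norm_add_le _ _

theorem vnorm_pos {x : Fin d → k} (hx : x ≠ 0) : 0 < vnorm x := by
  by_cases h : IsNonarch k
  · rw [vnorm_nonarch h]; exact norm_pos_iff.2 hx
  · rw [vnorm_arch h]; apply norm_pos_iff.2
    intro h0; apply hx; simpa using h0

theorem wnorm_congr_norm {x y x' y' : Fin d → k} (t : ℝ) (ht : 0 ≤ t)
    (h : ∀ i j, ‖x' i * y' j - x' j * y' i‖ = t * ‖x i * y j - x j * y i‖) :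
    wnorm x' y' = t * wnorm x y := by
  unfold wnorm
  split_ifs with hna
  · simp only [h]
    rw [Real.mul_iSup_of_nonneg ht]
  · simp only [h, mul_pow]
    rw [← Real.sqrt_sq ht, ← Real.sqrt_mul (sq_nonneg t), Finset.mul_sum, Real.sqrt_sq ht]
    congr 1
    refine Finset.sum_congr rfl fun p _ => ?_
    split_ifs <;> simp

theorem contraction [CompleteSpace k] [LocallyCompactSpace k] (c x y : Fin d → k) :
    vnorm ((∑ i, c i * x i) • y - (∑ i, c i * y i) • x) ≤ vnorm c * wnorm x y := by
  have hcoord : ∀ j, ((∑ i, c i * x i) • y - (∑ i, c i * y i) • x) j =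
      ∑ i, c i * (x i * y j - x j * y i) := by
    intro j
    simp only [Pi.sub_apply, Pi.smul_apply, smul_eq_mul, Finset.sum_mul]
    rw [← Finset.sum_sub_distrib]
    exact Finset.sum_congr rfl fun i _ => by ring
  by_cases h : IsNonarch k
  · have hb : BddAbove (Set.range fun p : Fin d × Fin d => ‖x p.1 * y p.2 - x p.2 * y p.1‖) :=
      (Set.finite_range _).bddAbove
    have hw0 : 0 ≤ wnorm x y := by
      rw [wnorm, if_pos h]; exact Real.iSup_nonneg fun _ => norm_nonneg _
    have hw : ∀ i j, ‖x i * y j - x j * y i‖ ≤ wnorm x y := by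
      intro i j
      rw [wnorm, if_pos h]
      exact le_ciSup hb (i, j)
    rw [vnorm_nonarch h, vnorm_nonarch h]
    have hU : IsUltrametricDist k :=
      IsUltrametricDist.isUltrametricDist_of_forall_norm_add_le_max_norm h
    rw [pi_norm_le_iff_of_nonneg (mul_nonneg (norm_nonneg _) hw0)]
    intro j
    rw [hcoord]
    refine IsUltrametricDist.norm_sum_le_of_forall_le_of_nonneg
      (mul_nonneg (norm_nonneg _) hw0) fun i _ => ?_
    rw [norm_mul]
    exact mul_le_mul (norm_le_pi_norm c i) (hw i j) (norm_nonneg _) (norm_nonneg _)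
  · obtain ⟨φ, α, hα0, hα1, hφ, -⟩ := arch_embed h
    have hsq : ∀ z : k, ‖z‖ ^ 2 = ‖φ z‖ ^ (2 * α) := by
      intro z
      rw [hφ, mul_comm, Real.rpow_mul (norm_nonneg _), Real.rpow_two]
    have hlp := lp_bound (2 * α) (by linarith) (by linarith) (fun i => φ (c i))
      (fun i j => φ (x i * y j - x j * y i)) (fun i j => by rw [← map_neg]; congr 1; ring)
    unfold vnorm wnorm
    rw [if_neg h, if_neg h, if_neg h, ← Real.sqrt_mul (Finset.sum_nonneg fun _ _ => sq_nonneg _)]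
    apply Real.sqrt_le_sqrt
    simp only [hcoord, hsq, map_sum, map_mul]
    simpa only [map_mul] using hlp

theorem exists_scale [CompleteSpace k] [LocallyCompactSpace k] (u v : Fin d → k) (hu : u ≠ 0)
    (hv : v ≠ 0) : ∃ s : k, vnorm (s • u) = vnorm v := by
  by_cases h : IsNonarch k
  · obtain ⟨i0, hi0⟩ := Function.ne_iff.1 hu
    have hne : Nonempty (Fin d) := ⟨i0⟩
    have hmax : ∀ x : Fin d → k, ∃ i, ‖x i‖ = vnorm x := by
      intro x
      obtain ⟨i, hi⟩ := exists_eq_ciSup_of_finite (f := fun i => ‖x i‖)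
      exact ⟨i, by rw [vnorm, if_pos h]; exact hi⟩
    obtain ⟨i, hi⟩ := hmax u
    obtain ⟨j, hj⟩ := hmax v
    refine ⟨v j / u i, ?_⟩
    have := (vnorm_pos hu).ne'
    rw [vnorm_smul, norm_div, hi, hj]
    field_simp
  · obtain ⟨φ, α, -, -, -, hs⟩ := arch_embed h
    obtain ⟨s, hs⟩ := hs (vnorm v / vnorm u) (div_pos (vnorm_pos hv) (vnorm_pos hu))
    refine ⟨s, ?_⟩
    have := (vnorm_pos hu).ne'
    rw [vnorm_smul, hs]
    field_simp

theorem lip [CompleteSpace k] [LocallyCompactSpace k] (x y c : Fin d → k) (hx : x ≠ 0)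
    (hy : y ≠ 0) (hc : c ≠ 0) : pdistH y c - pdistH x c ≤ pdist x y := by
  have h1 := contraction c x y
  have h2 : vnorm ((∑ i, c i * y i) • x) ≤
      vnorm ((∑ i, c i * x i) • y) + vnorm ((∑ i, c i * x i) • y - (∑ i, c i * y i) • x) := by
    have e : (∑ i, c i * y i) • x = (∑ i, c i * x i) • y +
        (-1 : k) • ((∑ i, c i * x i) • y - (∑ i, c i * y i) • x) := by
      rw [neg_one_smul]; abel
    conv_lhs => rw [e]
    refine (vnorm_add_le _ _).trans ?_
    rw [vnorm_smul (-1 : k)]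
    simp
  rw [vnorm_smul, vnorm_smul] at h2
  have px := vnorm_pos hx
  have py := vnorm_pos hy
  have pc := vnorm_pos hc
  unfold pdistH pdist
  rw [div_sub_div _ _ (by positivity) (by positivity), div_le_div_iff₀ (by positivity)
    (by positivity)]
  have h3 : ‖∑ i, c i * y i‖ * vnorm x - ‖∑ i, c i * x i‖ * vnorm y ≤ vnorm c * wnorm x y := by
    linarith
  have h4 := mul_le_mul_of_nonneg_left h3
    (show 0 ≤ vnorm c * (vnorm x * vnorm y) by positivity)
  nlinarith [h4]

theorem exists_far [CompleteSpace k] [LocallyCompactSpace k] (hd : 2 ≤ d) (v c : Fin d → k)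
    (hv : v ≠ 0) (hc : c ≠ 0) {r ε : ℝ} (hε : 0 < ε) (hr : 2 * ε < r) (h : r ≤ pdistH v c) :
    ∃ q : Fin d → k, q ≠ 0 ∧ ε < pdistH q c ∧ ε < pdist q v := by
  obtain ⟨i, hi⟩ := Function.ne_iff.1 hc
  have hi : c i ≠ 0 := hi
  obtain ⟨j, hj⟩ : ∃ j : Fin d, j ≠ i := by
    have : Nontrivial (Fin d) := Fin.nontrivial_iff_two_le.2 hd
    exact exists_ne i
  let u0 : Fin d → k := Pi.single j (c i) - Pi.single i (c j)
  have hu0 : u0 ≠ 0 := by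
    intro h0
    have := congrFun h0 j
    simp [u0, hj] at this
    exact hi this
  have hcu0 : ∑ l, c l * u0 l = 0 := by
    simp only [u0, Pi.sub_apply, mul_sub, Finset.sum_sub_distrib, Pi.single_apply, mul_ite,
      mul_zero, Finset.sum_ite_eq', Finset.mem_univ, if_true]
    ring
  obtain ⟨s, hs⟩ := exists_scale u0 v hu0 hv
  set u : Fin d → k := s • u0 with hu
  have hcu : ∑ l, c l * u l = 0 := by
    have : ∑ l, c l * u l = s * ∑ l, c l * u0 l := by
      rw [Finset.mul_sum]
      exact Finset.sum_congr rfl fun l _ => by simp [hu]; ring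
    rw [this, hcu0, mul_zero]
  have pv := vnorm_pos hv
  have pc := vnorm_pos hc
  have hfq : ∑ l, c l * (v + u) l = ∑ l, c l * v l := by
    simp only [Pi.add_apply, mul_add, Finset.sum_add_distrib, hcu, add_zero]
  have hfv : 2 * ε * (vnorm c * vnorm v) < ‖∑ l, c l * v l‖ := by
    have h1 : 2 * ε < pdistH v c := lt_of_lt_of_le hr h
    rw [pdistH, lt_div_iff₀ (by positivity)] at h1
    exact h1
  have hq : v + u ≠ 0 := by
    intro h0
    rw [h0] at hfq
    simp only [Pi.zero_apply, mul_zero, Finset.sum_const_zero] at hfq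
    rw [← hfq, norm_zero] at hfv
    have : 0 < 2 * ε * (vnorm c * vnorm v) := by positivity
    linarith
  have pq := vnorm_pos hq
  have hqle : vnorm (v + u) ≤ 2 * vnorm v := by
    have := vnorm_add_le v u
    rw [hs] at this; linarith
  have hw : wnorm (v + u) v = wnorm v u := by
    rw [wnorm_congr_norm (x := v) (y := u) 1 zero_le_one, one_mul]
    intro a b
    rw [one_mul, ← norm_neg]
    congr 1
    simp only [Pi.add_apply]; ring
  have hcon := contraction c v u
  rw [hcu, zero_smul, sub_zero, vnorm_smul, hs] at hcon
  refine ⟨v + u, hq, ?_, ?_⟩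
  · rw [pdistH, hfq, lt_div_iff₀ (by positivity)]
    have := mul_le_mul_of_nonneg_left hqle (show 0 ≤ ε * vnorm c by positivity)
    nlinarith
  · rw [pdist, hw, lt_div_iff₀ (by positivity)]
    have h1 := mul_lt_mul_of_pos_right hfv pv
    have h2 : 2 * ε * (vnorm v * vnorm v) < wnorm v u := by
      have : vnorm c * (2 * ε * (vnorm v * vnorm v)) < vnorm c * wnorm v u := by
        calc _ = 2 * ε * (vnorm c * vnorm v) * vnorm v := by ring
          _ < _ := h1
          _ ≤ _ := hcon
      exact lt_of_mul_lt_mul_left this pc.le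
    have := mul_le_mul_of_nonneg_left hqle (show 0 ≤ ε * vnorm v by positivity)
    nlinarith

theorem pdeltaH_mk (q c : Fin d → k) (hq : q ≠ 0) :
    pdeltaH (Projectivization.mk k q hq) c = pdistH q c := by
  obtain ⟨t, ht⟩ := Projectivization.exists_smul_eq_mk_rep k q hq
  have ht0 : ‖(t : k)‖ ≠ 0 := norm_ne_zero_iff.2 t.ne_zero
  rw [pdeltaH, ← ht, Units.smul_def, pdistH, pdistH, vnorm_smul]
  have : ∑ i, c i * ((t : k) • q) i = t * ∑ i, c i * q i := by
    rw [Finset.mul_sum]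
    exact Finset.sum_congr rfl fun l _ => by simp; ring
  rw [this, norm_mul, mul_left_comm, mul_div_mul_left _ _ ht0]

theorem pdelta_mk (q : Fin d → k) (hq : q ≠ 0) (P : Projectivization k (Fin d → k)) :
    pdelta (Projectivization.mk k q hq) P = pdist q P.rep := by
  obtain ⟨t, ht⟩ := Projectivization.exists_smul_eq_mk_rep k q hq
  have ht0 : ‖(t : k)‖ ≠ 0 := norm_ne_zero_iff.2 t.ne_zero
  rw [pdelta, ← ht, Units.smul_def, pdist, pdist, vnorm_smul,
    wnorm_congr_norm (x := q) (y := P.rep) ‖(t : k)‖ (norm_nonneg _), mul_assoc,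
    mul_div_mul_left _ _ ht0]
  intro i j
  rw [← norm_mul]
  congr 1
  simp only [Pi.smul_apply, smul_eq_mul]; ring

theorem pactGL_mul (g h : Matrix.GeneralLinearGroup (Fin d) k)
    (Q : Projectivization k (Fin d → k)) : pactGL (g * h) Q = pactGL g (pactGL h Q) := by
  induction Q using Projectivization.ind with
  | h v hv =>
    simp only [pactGL, Projectivization.map_mk]
    congr 1
    simp [Matrix.mulVec_mulVec]

theorem pactGL_one (Q : Projectivization k (Fin d → k)) :
    pactGL (1 : Matrix.GeneralLinearGroup (Fin d) k) Q = Q := by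
  induction Q using Projectivization.ind with
  | h v hv =>
    simp only [pactGL, Projectivization.map_mk]
    congr 1
    simp

end geometry

/-- ping-pong lemma: if `[a_1], …, [a_m]` form a ping-pong
`m`-tuple, then they freely generate a free subgroup of `PGL_d(k)`: any reduced word
acting trivially on `P(k^d)` (i.e. trivial in `PGL`) is the trivial word. -/
theorem statement_16
    {k : Type*} [NontriviallyNormedField k] [CompleteSpace k] [LocallyCompactSpace k]
    {d : ℕ} (hd : 2 ≤ d) {m : ℕ}
    (a : Fin m → Matrix.GeneralLinearGroup (Fin d) k)
    (hpp : PingPongTuple a) :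
    ∀ ww : FreeGroup (Fin m),
      (∀ Q : Projectivization k (Fin d → k), pactGL (FreeGroup.lift a ww) Q = Q) →
      ww = 1 := by

  obtain ⟨r, ε, v, w, c, cw, hε, hr, hc, hcw, hpa, hpb, hij⟩ := hpp
  let g : Fin m × Bool → Matrix.GeneralLinearGroup (Fin d) k :=
    fun s => cond s.2 (a s.1) (a s.1)⁻¹
  let V : Fin m × Bool → Projectivization k (Fin d → k) := fun s => cond s.2 (v s.1) (w s.1)
  let C : Fin m × Bool → (Fin d → k) := fun s => cond s.2 (c s.1) (cw s.1)
  have hC : ∀ s, C s ≠ 0 := by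
    rintro ⟨i, b⟩
    cases b
    · exact hcw i
    · exact hc i
  have hg : ∀ s, EpsContracting (g s) (V s) (C s) ε := by
    rintro ⟨i, b⟩
    cases b
    · exact (hpb i).1
    · exact (hpa i).1
  have hVC : ∀ s t : Fin m × Bool, (s.1 = t.1 → s.2 = t.2) → r ≤ pdeltaH (V s) (C t) := by
    rintro ⟨i, b⟩ ⟨j, b'⟩ hst
    by_cases h : i = j
    · subst h
      have : b = b' := hst rfl
      subst this
      cases b
      · exact (hpb i).2.le
      · exact (hpa i).2.le
    · obtain ⟨h1, h2, h3, h4⟩ := hij i j h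
      cases b <;> cases b'
      · exact h4
      · exact h3
      · exact h2
      · exact h1
  have hword : ∀ (L : List (Fin m × Bool)) (s : Fin m × Bool), FreeGroup.IsReduced (s :: L) →
      ∀ Q : Projectivization k (Fin d → k),
        (∀ l ∈ (s :: L).getLast?, ε < pdeltaH Q (C l)) →
        pdelta (pactGL ((s :: L).map g).prod Q) (V s) < ε := by
    intro L
    induction L with
    | nil =>
      intro s _ Q hQ
      simp only [List.map_cons, List.map_nil, List.prod_cons, List.prod_nil, mul_one]
      exact hg s Q (hQ s (by simp))
    | cons t L ih =>
      intro s hred Q hQ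
      rw [FreeGroup.isReduced_cons_cons] at hred
      have h1 := ih t hred.2 Q (fun l hl => hQ l (by simpa using hl))
      rw [List.map_cons, List.prod_cons, pactGL_mul]
      apply hg s
      set P := pactGL ((t :: L).map g).prod Q
      have h2 := hVC t s (fun h => (hred.1 h.symm).symm)
      have h3 := lip P.rep (V t).rep (C s) P.rep_nonzero (V t).rep_nonzero (hC s)
      change pdeltaH (V t) (C s) - pdeltaH P (C s) ≤ pdelta P (V t) at h3
      linarith
  intro ww hww
  set L := FreeGroup.reduceCyclically ww.toWord with hL
  set K := FreeGroup.reduceCyclically.conjugator ww.toWord with hK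
  have hcr : FreeGroup.IsCyclicallyReduced L :=
    FreeGroup.reduceCyclically.isCyclicallyReduced FreeGroup.isReduced_toWord
  have hconj : ww = FreeGroup.mk K * FreeGroup.mk L * (FreeGroup.mk K)⁻¹ := by
    conv_lhs => rw [← FreeGroup.mk_toWord (x := ww),
      ← FreeGroup.reduceCyclically.conj_conjugator_reduceCyclically ww.toWord]
    rw [FreeGroup.inv_mk, FreeGroup.mul_mk, FreeGroup.mul_mk]
  have htriv : ∀ Q, pactGL (FreeGroup.lift a (FreeGroup.mk L)) Q = Q := by
    intro Q
    have e : FreeGroup.mk L = (FreeGroup.mk K)⁻¹ * ww * FreeGroup.mk K := by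
      rw [hconj]; group
    rw [e, map_mul, map_mul, pactGL_mul, pactGL_mul, hww, ← pactGL_mul, ← map_mul,
      inv_mul_cancel, map_one, pactGL_one]
  rcases hLe : L with _ | ⟨s, L'⟩
  · rw [hconj, hLe]
    rw [← FreeGroup.one_eq_mk, mul_one, mul_inv_cancel]
  · exfalso
    rw [hLe] at hcr htriv
    obtain ⟨l, hl⟩ : ∃ l, (s :: L').getLast? = some l :=
      ⟨_, List.getLast?_eq_getLast_of_ne_nil (List.cons_ne_nil _ _)⟩
    have h1 := hVC s l (fun h => (hcr.2 l hl s (by simp) h.symm).symm)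
    obtain ⟨q, hq, h2, h3⟩ := exists_far hd (V s).rep (C l) (V s).rep_nonzero (hC l) hε hr h1
    have h4 := hword L' s hcr.1 (Projectivization.mk k q hq) (by
      intro l' hl'
      have : l' = l := by
        rw [hl] at hl'; simpa using hl'.symm
      rw [this, pdeltaH_mk]; exact h2)
    have h5 : ((s :: L').map g).prod = FreeGroup.lift a (FreeGroup.mk (s :: L')) := by
      rw [FreeGroup.lift_mk]
    rw [h5, htriv, pdelta_mk] at h4
    linarith
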